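/- Let K ⊂ ℝⁿ be a proper cone admitting a ν-LHSCB F with conjugate F_*. Let x ∈ int K and s ∈ int K*, write r := ‖δP‖_x, and assume 0 < r ≤ 0.18226, ⟨δP, δD⟩ ≠ 0, and ‖x̃‖_x² ≠ ν·μ̃². Define W := μ·F''(x) + s·sᵀ/(ν·μ) − μ·s̃·s̃ᵀ/ν + δD·(δD)ᵀ/⟨δP,δD⟩ − μ·(F''(x)·x̃ − μ̃·s̃)·(F''(x)·x̃ − μ̃·s̃)ᵀ/(‖x̃‖_x² − ν·μ̃²), and set ε₁ := (1/ν)·(r + r²/(1−r)³)·(r + r²/(1−r)³ + 2√ν) and ε₂ := (2/((1−r)³ − r))·(4r²/(1−r)³ + 2r + (3r²/(1−r)³ + r)²/(r·(1 − 3r/(1−r)³))). Then (1 − ε₁ − ε₂)·μ·F''(x) ⪯ W ⪯ (1 + ε₁ + ε₂)·μ·F''(x), and (1 − ε₁ − ε₂)·(1 − r)²·(1/μ)·F_*''(s)⁻¹ ⪯ W ⪯ ((1 + ε₁ + ε₂)/(1 − r)²)·(1/μ)·F_*''(s)⁻¹. -/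

import Mathlib

open Matrix

/-- The norm induced by a (positive definite) matrix `P`: `‖v‖_P = √(vᵀ P v)`. -/
noncomputable def vnorm {n : ℕ} (P : Matrix (Fin n) (Fin n) ℝ) (v : Fin n → ℝ) : ℝ :=
  Real.sqrt (v ⬝ᵥ (P *ᵥ v))

/-- The operator norm `‖Q‖_P = sup {‖Q u‖_{P⁻¹} : ‖u‖_P ≤ 1}`. -/
noncomputable def opNorm {n : ℕ} (P Q : Matrix (Fin n) (Fin n) ℝ) : ℝ :=
  sSup ((fun u => vnorm P⁻¹ (Q *ᵥ u)) '' {u : Fin n → ℝ | vnorm P u ≤ 1})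

/-- The Loewner order: `Loewner P Q` means `P ⪯ Q`, i.e. `Q - P` is positive semidefinite. -/
def Loewner {n : ℕ} (P Q : Matrix (Fin n) (Fin n) ℝ) : Prop :=
  (Q - P).PosSemidef

/-- A ν-logarithmically homogeneous self-concordant barrier `F` for a proper cone `K ⊆ ℝⁿ`,
with gradient `grad` and Hessian `hess`. -/
structure LHSCB (n : ℕ) (ν : ℝ) where
  K : Set (Fin n → ℝ)
  F : (Fin n → ℝ) → ℝ
  grad : (Fin n → ℝ) → (Fin n → ℝ)
  hess : (Fin n → ℝ) → Matrix (Fin n) (Fin n) ℝ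
  nu_ge_one : 1 ≤ ν
  cone_convex : Convex ℝ K
  cone_closed : IsClosed K
  cone_pointed : ∀ x, x ∈ K → -x ∈ K → x = 0
  cone_fullDim : (interior K).Nonempty
  cone_smul : ∀ t : ℝ, 0 < t → ∀ x ∈ K, t • x ∈ K
  smooth : ContDiffOn ℝ 3 F (interior K)
  strictConvex : StrictConvexOn ℝ (interior K) F
  grad_eq : ∀ x ∈ interior K, ∀ v, fderiv ℝ F x v = grad x ⬝ᵥ v
  hess_eq : ∀ x ∈ interior K, ∀ u, fderiv ℝ grad x u = hess x *ᵥ u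
  hess_symm : ∀ x ∈ interior K, (hess x).IsSymm
  hess_posdef : ∀ x ∈ interior K, (hess x).PosDef
  logHom : ∀ t : ℝ, 0 < t → ∀ x ∈ interior K, F (t • x) = F x - ν * Real.log t
  dikin : ∀ x ∈ interior K, ∀ y, vnorm (hess x) (y - x) < 1 → y ∈ interior K
  selfConc : ∀ x ∈ interior K, ∀ x' ∈ interior K, vnorm (hess x) (x' - x) < 1 →
    Loewner ((1 - vnorm (hess x) (x' - x)) ^ 2 • hess x') (hess x) ∧
    Loewner (hess x) (((1 - vnorm (hess x) (x' - x)) ^ 2)⁻¹ • hess x')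

/-- A ν-LHSCB `B` for a proper cone `K` together with its conjugate barrier `Bstar`
(a ν-LHSCB for the dual cone `K*`, equal on `int K*` to the convex conjugate of `B.F`). -/
structure LHSCBPair (n : ℕ) (ν : ℝ) where
  B : LHSCB n ν
  Bstar : LHSCB n ν
  dual_eq : Bstar.K = {s | ∀ x ∈ B.K, 0 ≤ x ⬝ᵥ s}
  conj_eq : ∀ s ∈ interior Bstar.K,
    Bstar.F s = sSup ((fun x => -(s ⬝ᵥ x) - B.F x) '' interior B.K)

section QuadraticForms

variable {n : ℕ}

theorem loewner_iff {P Q : Matrix (Fin n) (Fin n) ℝ} (hP : P.IsSymm) (hQ : Q.IsSymm) :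
    Loewner P Q ↔ ∀ u, u ⬝ᵥ (P *ᵥ u) ≤ u ⬝ᵥ (Q *ᵥ u) := by
  constructor
  · intro h u
    have := Matrix.PosSemidef.dotProduct_mulVec_nonneg h u
    simpa [Matrix.sub_mulVec, dotProduct_sub] using this
  · intro h
    refine Matrix.PosSemidef.of_dotProduct_mulVec_nonneg ?_ fun u => ?_
    · rw [Matrix.IsHermitian, Matrix.conjTranspose_eq_transpose_of_trivial]
      exact hQ.sub hP
    · simpa [Matrix.sub_mulVec, dotProduct_sub] using h u

theorem dotProduct_mulVec_symm {H : Matrix (Fin n) (Fin n) ℝ} (hH : H.IsSymm)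
    (u v : Fin n → ℝ) : u ⬝ᵥ (H *ᵥ v) = v ⬝ᵥ (H *ᵥ u) := by
  rw [Matrix.dotProduct_mulVec, ← Matrix.mulVec_transpose, hH.eq, dotProduct_comm]

theorem Matrix.PosDef.dotProduct_mulVec_self_nonneg {H : Matrix (Fin n) (Fin n) ℝ}
    (hH : H.PosDef) (u : Fin n → ℝ) : 0 ≤ u ⬝ᵥ (H *ᵥ u) := by
  simpa using hH.posSemidef.dotProduct_mulVec_nonneg u

theorem Matrix.PosDef.isSymm {H : Matrix (Fin n) (Fin n) ℝ} (hH : H.PosDef) : H.IsSymm := by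
  have := hH.isHermitian
  rwa [Matrix.IsHermitian, Matrix.conjTranspose_eq_transpose_of_trivial] at this

theorem vnorm_nonneg (H : Matrix (Fin n) (Fin n) ℝ) (u : Fin n → ℝ) : 0 ≤ vnorm H u :=
  Real.sqrt_nonneg _

theorem vnorm_sq {H : Matrix (Fin n) (Fin n) ℝ} (hH : H.PosDef) (u : Fin n → ℝ) :
    vnorm H u ^ 2 = u ⬝ᵥ (H *ᵥ u) :=
  Real.sq_sqrt (hH.dotProduct_mulVec_self_nonneg u)

theorem vnorm_smul (H : Matrix (Fin n) (Fin n) ℝ) (c : ℝ) (u : Fin n → ℝ) :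
    vnorm H (c • u) = |c| * vnorm H u := by
  unfold vnorm
  rw [Matrix.mulVec_smul, dotProduct_smul, smul_dotProduct, smul_eq_mul, smul_eq_mul, ← mul_assoc,
    Real.sqrt_mul (mul_self_nonneg c), Real.sqrt_mul_self_eq_abs]

theorem vnorm_neg (H : Matrix (Fin n) (Fin n) ℝ) (u : Fin n → ℝ) :
    vnorm H (-u) = vnorm H u := by
  simpa using vnorm_smul H (-1) u

theorem vnorm_pos {H : Matrix (Fin n) (Fin n) ℝ} (hH : H.PosDef) {u : Fin n → ℝ} (hu : u ≠ 0) :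
    0 < vnorm H u :=
  Real.sqrt_pos.2 (by simpa using hH.dotProduct_mulVec_pos hu)

theorem continuous_vnorm (H : Matrix (Fin n) (Fin n) ℝ) : Continuous (vnorm H) := by
  unfold vnorm
  fun_prop

/-- A symmetric bilinear form dominated on the diagonal by `c • H` is bounded by `c`
with respect to the norm of `H`. -/
theorem abs_dotProduct_mulVec_le {H M : Matrix (Fin n) (Fin n) ℝ} (hH : H.PosDef)
    (hM : M.IsSymm) {c : ℝ} (h : ∀ v, |v ⬝ᵥ (M *ᵥ v)| ≤ c * (v ⬝ᵥ (H *ᵥ v)))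
    (u v : Fin n → ℝ) : |u ⬝ᵥ (M *ᵥ v)| ≤ c * vnorm H u * vnorm H v := by
  rcases eq_or_ne u 0 with rfl | hu
  · simp [vnorm]
  rcases eq_or_ne v 0 with rfl | hv
  · simp [vnorm]
  have hu' := vnorm_pos hH hu
  have hv' := vnorm_pos hH hv
  set a := vnorm H u with ha
  set b := vnorm H v with hb
  have h1 := h (b • u + a • v)
  have h2 := h (b • u - a • v)
  have hU := vnorm_sq hH u
  have hV := vnorm_sq hH v
  simp only [Matrix.mulVec_add, Matrix.mulVec_sub, Matrix.mulVec_smul, dotProduct_add,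
    dotProduct_sub, add_dotProduct, sub_dotProduct, dotProduct_smul, smul_dotProduct, smul_eq_mul,
    dotProduct_mulVec_symm hM v u, dotProduct_mulVec_symm hH.isSymm v u, ← hU, ← hV,
    ← ha, ← hb] at h1 h2
  rw [abs_le] at h1 h2 ⊢
  have hab : 0 < a * b := mul_pos hu' hv'
  constructor
  · refine le_of_mul_le_mul_left ?_ hab
    linarith
  · refine le_of_mul_le_mul_left ?_ hab
    linarith

theorem abs_dotProduct_mulVec_le_vnorm {H : Matrix (Fin n) (Fin n) ℝ} (hH : H.PosDef)
    (u v : Fin n → ℝ) : |u ⬝ᵥ (H *ᵥ v)| ≤ vnorm H u * vnorm H v := by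
  simpa using abs_dotProduct_mulVec_le hH hH.isSymm (c := 1)
    (fun v => by rw [one_mul, abs_of_nonneg (hH.dotProduct_mulVec_self_nonneg v)]) u v

end QuadraticForms

namespace LHSCB

variable {n : ℕ} {ν : ℝ} (B : LHSCB n ν)

open scoped Pointwise in
theorem smul_mem_interior {t : ℝ} (ht : 0 < t) {x : Fin n → ℝ} (hx : x ∈ interior B.K) :
    t • x ∈ interior B.K := by
  have h : interior (t • B.K) ⊆ interior B.K := by
    refine interior_mono ?_
    rintro _ ⟨y, hy, rfl⟩
    exact B.cone_smul t ht y hy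
  rw [interior_smul₀ ht.ne'] at h
  exact h (Set.smul_mem_smul_set hx)

theorem nu_pos {n : ℕ} {ν : ℝ} (B : LHSCB n ν) : 0 < ν :=
  lt_of_lt_of_le one_pos B.nu_ge_one

theorem ne_zero_of_mem_interior {x : Fin n → ℝ} (hx : x ∈ interior B.K) : x ≠ 0 := by
  rintro rfl
  have h := B.logHom 2 two_pos 0 hx
  have h2 : 0 < Real.log 2 := Real.log_pos one_lt_two
  have := mul_pos B.nu_pos h2
  simp only [smul_zero] at h
  linarith

theorem hasFDerivAt_F {x : Fin n → ℝ} (hx : x ∈ interior B.K) :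
    HasFDerivAt B.F (LinearMap.toContinuousLinearMap (dotProductBilin ℝ ℝ (B.grad x))) x := by
  have h : DifferentiableAt ℝ B.F x :=
    (B.smooth.contDiffAt (isOpen_interior.mem_nhds hx)).differentiableAt (by norm_num)
  convert h.hasFDerivAt using 1
  ext1 v
  rw [B.grad_eq x hx v]
  rfl

theorem hasFDerivAt_grad {x : Fin n → ℝ} (hx : x ∈ interior B.K) :
    HasFDerivAt B.grad (LinearMap.toContinuousLinearMap (B.hess x).mulVecLin) x := by
  have h : DifferentiableAt ℝ B.grad x := by
    by_contra hd
    have h0 := B.hess_eq x hx x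
    rw [fderiv_zero_of_not_differentiableAt hd] at h0
    have h1 := (B.hess_posdef x hx).dotProduct_mulVec_pos (B.ne_zero_of_mem_interior hx)
    rw [← h0] at h1
    simp at h1
  convert h.hasFDerivAt using 1
  ext1 v
  rw [B.hess_eq x hx v]
  rfl

theorem hasDerivAt_F_line {x d : Fin n → ℝ} {t : ℝ} (hx : x + t • d ∈ interior B.K) :
    HasDerivAt (fun τ : ℝ => B.F (x + τ • d)) (B.grad (x + t • d) ⬝ᵥ d) t := by
  have h : HasDerivAt (fun τ : ℝ => x + τ • d) d t := by
    simpa using ((hasDerivAt_id t).smul_const d).const_add x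
  exact (B.hasFDerivAt_F hx).comp_hasDerivAt t h

theorem hasDerivAt_grad_line {x d : Fin n → ℝ} {t : ℝ} (hx : x + t • d ∈ interior B.K) :
    HasDerivAt (fun τ : ℝ => B.grad (x + τ • d)) (B.hess (x + t • d) *ᵥ d) t := by
  have h : HasDerivAt (fun τ : ℝ => x + τ • d) d t := by
    simpa using ((hasDerivAt_id t).smul_const d).const_add x
  exact (B.hasFDerivAt_grad hx).comp_hasDerivAt t h

theorem hasDerivAt_dotProduct_grad_line (u : Fin n → ℝ) {x d : Fin n → ℝ} {t : ℝ}
    (hx : x + t • d ∈ interior B.K) :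
    HasDerivAt (fun τ : ℝ => u ⬝ᵥ B.grad (x + τ • d)) (u ⬝ᵥ (B.hess (x + t • d) *ᵥ d)) t :=
  (LinearMap.toContinuousLinearMap (dotProductBilin ℝ ℝ u)).hasFDerivAt.comp_hasDerivAt t
    (B.hasDerivAt_grad_line hx)

theorem grad_smul {t : ℝ} (ht : 0 < t) {x : Fin n → ℝ} (hx : x ∈ interior B.K) :
    B.grad (t • x) = t⁻¹ • B.grad x := by
  have h1 := (B.hasFDerivAt_F (B.smul_mem_interior ht hx)).comp x
    ((hasFDerivAt_id (𝕜 := ℝ) x).const_smul t)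
  have h2 := (B.hasFDerivAt_F hx).sub_const (ν * Real.log t)
  have h3 := h1.unique (h2.congr_of_eventuallyEq (by
    filter_upwards [isOpen_interior.mem_nhds hx] with y hy using B.logHom t ht y hy))
  refine dotProduct_eq _ _ fun u => ?_
  have h4 := congrArg (fun L => L u) h3
  have h5 : t * (B.grad (t • x) ⬝ᵥ u) = B.grad x ⬝ᵥ u := by
    simpa using h4
  rw [smul_dotProduct, ← h5, smul_eq_mul, inv_mul_cancel_left₀ ht.ne']

theorem hess_smul {t : ℝ} (ht : 0 < t) {x : Fin n → ℝ} (hx : x ∈ interior B.K) :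
    B.hess (t • x) = (t ^ 2)⁻¹ • B.hess x := by
  have h1 := (B.hasFDerivAt_grad (B.smul_mem_interior ht hx)).comp x
    ((hasFDerivAt_id (𝕜 := ℝ) x).const_smul t)
  have h2 := (B.hasFDerivAt_grad hx).const_smul t⁻¹
  have h3 := h1.unique (h2.congr_of_eventuallyEq (by
    filter_upwards [isOpen_interior.mem_nhds hx] with y hy using B.grad_smul ht hy))
  refine Matrix.mulVec_injective (funext fun u => ?_)
  have h4 := congrArg (fun L => L u) h3
  have h5 : t • (B.hess (t • x) *ᵥ u) = t⁻¹ • (B.hess x *ᵥ u) := by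
    simpa [Matrix.mulVec_smul] using h4
  rw [Matrix.smul_mulVec, pow_two, mul_inv, mul_smul, ← h5, smul_smul, inv_mul_cancel₀ ht.ne',
    one_smul]

theorem grad_dotProduct_self {x : Fin n → ℝ} (hx : x ∈ interior B.K) :
    B.grad x ⬝ᵥ x = -ν := by
  have h1 := B.hasDerivAt_F_line (x := x) (d := x) (t := 0) (by simpa using hx)
  have h2 : HasDerivAt (fun τ : ℝ => B.F x - ν * Real.log (1 + τ)) (-ν) 0 := by
    have h : HasDerivAt (fun τ : ℝ => 1 + τ) 1 0 := (hasDerivAt_id 0).const_add 1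
    simpa using ((h.log (by simp)).const_mul ν).const_sub (B.F x)
  simp only [zero_smul, add_zero] at h1
  refine h1.unique (h2.congr_of_eventuallyEq ?_)
  filter_upwards [lt_mem_nhds (show (-1 : ℝ) < 0 by norm_num)] with τ hτ
  rw [← B.logHom (1 + τ) (by linarith) x hx, add_smul, one_smul]

theorem hess_mulVec_self {x : Fin n → ℝ} (hx : x ∈ interior B.K) :
    B.hess x *ᵥ x = -B.grad x := by
  have h1 := B.hasDerivAt_grad_line (x := x) (d := x) (t := 0) (by simpa using hx)
  have h2 : HasDerivAt (fun τ : ℝ => (1 + τ)⁻¹ • B.grad x) (-B.grad x) 0 := by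
    have h : HasDerivAt (fun τ : ℝ => 1 + τ) 1 0 := (hasDerivAt_id 0).const_add 1
    simpa using (h.inv (by simp)).smul_const (B.grad x)
  simp only [zero_smul, add_zero] at h1
  refine h1.unique (h2.congr_of_eventuallyEq ?_)
  filter_upwards [lt_mem_nhds (show (-1 : ℝ) < 0 by norm_num)] with τ hτ
  rw [← B.grad_smul (by linarith : 0 < 1 + τ) hx, add_smul, one_smul]

theorem add_mem_interior {x d : Fin n → ℝ} (hx : x ∈ interior B.K)
    (hd : vnorm (B.hess x) d < 1) : x + d ∈ interior B.K :=
  B.dikin x hx _ (by simpa using hd)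

theorem selfConc_quadratic {x d : Fin n → ℝ} (hx : x ∈ interior B.K)
    (hd : vnorm (B.hess x) d < 1) (v : Fin n → ℝ) :
    (1 - vnorm (B.hess x) d) ^ 2 * (v ⬝ᵥ (B.hess (x + d) *ᵥ v)) ≤ v ⬝ᵥ (B.hess x *ᵥ v) ∧
      (1 - vnorm (B.hess x) d) ^ 2 * (v ⬝ᵥ (B.hess x *ᵥ v)) ≤ v ⬝ᵥ (B.hess (x + d) *ᵥ v) := by
  have hx' := B.add_mem_interior hx hd
  have h := B.selfConc x hx (x + d) hx' (by simpa using hd)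
  have hs := B.hess_symm x hx
  have hs' := B.hess_symm _ hx'
  rw [loewner_iff (hs'.smul _) hs, loewner_iff hs (hs'.smul _)] at h
  have h1 := h.1 v
  have h2 := h.2 v
  simp only [add_sub_cancel_left, Matrix.smul_mulVec, dotProduct_smul, smul_eq_mul] at h1 h2
  refine ⟨h1, ?_⟩
  rwa [inv_mul_eq_div, le_div_iff₀ (by nlinarith), mul_comm] at h2

end LHSCB

namespace LHSCB

variable {n : ℕ} {ν : ℝ} (B : LHSCB n ν)

theorem abs_hess_sub_le {x d : Fin n → ℝ} (hx : x ∈ interior B.K)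
    (hd : vnorm (B.hess x) d < 1) (u v : Fin n → ℝ) :
    |u ⬝ᵥ ((B.hess (x + d) - B.hess x) *ᵥ v)| ≤
      (((1 - vnorm (B.hess x) d) ^ 2)⁻¹ - 1) * vnorm (B.hess x) u * vnorm (B.hess x) v := by
  have hx' := B.add_mem_interior hx hd
  refine abs_dotProduct_mulVec_le (B.hess_posdef x hx)
    ((B.hess_symm _ hx').sub (B.hess_symm x hx)) (fun w => ?_) u v
  obtain ⟨h1, h2⟩ := B.selfConc_quadratic hx hd w
  have hρ0 := vnorm_nonneg (B.hess x) d
  set ρ := vnorm (B.hess x) d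
  have hq := (B.hess_posdef x hx).dotProduct_mulVec_self_nonneg w
  have hp : 0 < (1 - ρ) ^ 2 := by nlinarith
  rw [← le_inv_mul_iff₀ hp] at h1
  have h3 : 1 - (1 - ρ) ^ 2 ≤ ((1 - ρ) ^ 2)⁻¹ - 1 := by
    have h4 : 2 - (1 - ρ) ^ 2 ≤ ((1 - ρ) ^ 2)⁻¹ := by
      rw [← one_div, le_div_iff₀ hp]
      nlinarith [sq_nonneg ((1 - ρ) ^ 2 - 1)]
    linarith
  have h5 := mul_le_mul_of_nonneg_right h3 hq
  rw [Matrix.sub_mulVec, dotProduct_sub, abs_le]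
  constructor <;> linarith

theorem dotProduct_grad_add_le {x d : Fin n → ℝ} (hx : x ∈ interior B.K)
    (hd : vnorm (B.hess x) d < 1) (u : Fin n → ℝ) :
    u ⬝ᵥ (B.grad (x + d) - B.grad x - B.hess x *ᵥ d) ≤
      vnorm (B.hess x) d ^ 2 / (1 - vnorm (B.hess x) d) * vnorm (B.hess x) u := by
  have hρ0 := vnorm_nonneg (B.hess x) d
  set ρ := vnorm (B.hess x) d with hρ
  set N := vnorm (B.hess x) u with hN
  have hvt : ∀ t ∈ Set.Icc (0 : ℝ) 1, vnorm (B.hess x) (t • d) = t * ρ := fun t ht => by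
    rw [vnorm_smul, abs_of_nonneg ht.1]
  have hlt : ∀ t ∈ Set.Icc (0 : ℝ) 1, t * ρ < 1 := fun t ht => by
    nlinarith [ht.1, ht.2]
  have hmem : ∀ t ∈ Set.Icc (0 : ℝ) 1, x + t • d ∈ interior B.K := fun t ht =>
    B.add_mem_interior hx (by rw [hvt t ht]; exact hlt t ht)
  have hf : ∀ t ∈ Set.Icc (0 : ℝ) 1, HasDerivAt
      (fun τ : ℝ => u ⬝ᵥ B.grad (x + τ • d) - τ * (u ⬝ᵥ (B.hess x *ᵥ d)))
      (u ⬝ᵥ (B.hess (x + t • d) *ᵥ d) - u ⬝ᵥ (B.hess x *ᵥ d)) t := fun t ht =>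
    (B.hasDerivAt_dotProduct_grad_line u (hmem t ht)).sub (hasDerivAt_mul_const _)
  have hg : ∀ t ∈ Set.Icc (0 : ℝ) 1, HasDerivAt
      (fun τ : ℝ => u ⬝ᵥ B.grad x + N * ((1 - τ * ρ)⁻¹ - 1 - τ * ρ))
      (N * (ρ / (1 - t * ρ) ^ 2 - ρ)) t := fun t ht => by
    have h1 : HasDerivAt (fun τ : ℝ => τ * ρ) ρ t := hasDerivAt_mul_const ρ
    have h2 := (h1.const_sub 1).inv (by linarith [hlt t ht])
    simpa using (((h2.sub_const 1).sub h1).const_mul N).const_add (u ⬝ᵥ B.grad x)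
  have key := image_le_of_deriv_right_le_deriv_boundary (a := 0) (b := 1)
    (fun t ht => (hf t ht).continuousAt.continuousWithinAt)
    (fun t ht => (hf t (Set.Ico_subset_Icc_self ht)).hasDerivWithinAt) (by simp)
    (fun t ht => (hg t ht).continuousAt.continuousWithinAt)
    (fun t ht => (hg t (Set.Ico_subset_Icc_self ht)).hasDerivWithinAt)
    (fun t ht => by
      have ht' := Set.Ico_subset_Icc_self ht
      have h := B.abs_hess_sub_le hx (d := t • d) (by rw [hvt t ht']; exact hlt t ht') u d
      rw [hvt t ht', Matrix.sub_mulVec, dotProduct_sub] at h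
      refine (le_of_abs_le h).trans_eq ?_
      rw [← hρ, ← hN]
      ring)
    (Set.right_mem_Icc.2 zero_le_one)
  simp only [one_smul, one_mul] at key
  have hfin : (1 - ρ)⁻¹ - 1 - ρ = ρ ^ 2 / (1 - ρ) := by
    have : 1 - ρ ≠ 0 := by linarith
    field_simp
    ring
  rw [hfin] at key
  rw [dotProduct_sub, dotProduct_sub]
  linarith

/-- First-order expansion of the gradient of a self-concordant function, in the local norm. -/
theorem abs_dotProduct_grad_add_le {x d : Fin n → ℝ} (hx : x ∈ interior B.K)
    (hd : vnorm (B.hess x) d < 1) (u : Fin n → ℝ) :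
    |u ⬝ᵥ (B.grad (x + d) - B.grad x - B.hess x *ᵥ d)| ≤
      vnorm (B.hess x) d ^ 2 / (1 - vnorm (B.hess x) d) * vnorm (B.hess x) u := by
  have h1 := B.dotProduct_grad_add_le hx hd u
  have h2 := B.dotProduct_grad_add_le hx hd (-u)
  rw [vnorm_neg, neg_dotProduct] at h2
  exact abs_le'.2 ⟨h1, h2⟩

/-- Uniform strong convexity of `F` on Dikin ellipsoids of radius one half. -/
theorem midpoint_le {x d : Fin n → ℝ} (hx : x ∈ interior B.K)
    (hd : vnorm (B.hess x) d = 1 / 2) :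
    1 / 64 ≤ B.F (x + d) + B.F x - 2 * B.F (x + (1 / 2 : ℝ) • d) := by
  have hvt : ∀ t ∈ Set.Icc (0 : ℝ) 1, vnorm (B.hess x) (t • d) = t / 2 := fun t ht => by
    rw [vnorm_smul, abs_of_nonneg ht.1, hd]
    ring
  have hmem : ∀ t ∈ Set.Icc (0 : ℝ) 1, x + t • d ∈ interior B.K := fun t ht =>
    B.add_mem_interior hx (by rw [hvt t ht]; linarith [ht.2])
  have hk : ∀ t ∈ Set.Icc (0 : ℝ) (1 / 2), HasDerivAt
      (fun τ : ℝ => B.F (x + (τ + 1 / 2) • d) - B.F (x + τ • d))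
      (B.grad (x + (t + 1 / 2) • d) ⬝ᵥ d - B.grad (x + t • d) ⬝ᵥ d) t := fun t ht => by
    have h1 := B.hasDerivAt_F_line (hmem (t + 1 / 2) ⟨by linarith [ht.1], by linarith [ht.2]⟩)
    have h2 := B.hasDerivAt_F_line (hmem t ⟨ht.1, by linarith [ht.2]⟩)
    exact (h1.comp_add_const t (1 / 2)).sub h2
  obtain ⟨ξ, hξ, hξ'⟩ := exists_hasDerivAt_eq_slope _ _ (by norm_num : (0 : ℝ) < 1 / 2)
    (fun t ht => (hk t ht).continuousAt.continuousWithinAt)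
    (fun t ht => hk t (Set.Ioo_subset_Icc_self ht))
  have hg : ∀ t ∈ Set.Icc ξ (ξ + 1 / 2), HasDerivAt (fun τ : ℝ => d ⬝ᵥ B.grad (x + τ • d))
      (d ⬝ᵥ (B.hess (x + t • d) *ᵥ d)) t := fun t ht =>
    B.hasDerivAt_dotProduct_grad_line d
      (hmem t ⟨by linarith [ht.1, hξ.1], by linarith [ht.2, hξ.2]⟩)
  obtain ⟨ζ, hζ, hζ'⟩ := exists_hasDerivAt_eq_slope _ _ (by linarith : ξ < ξ + 1 / 2)
    (fun t ht => (hg t ht).continuousAt.continuousWithinAt)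
    (fun t ht => hg t (Set.Ioo_subset_Icc_self ht))
  have hζ01 : ζ ∈ Set.Icc (0 : ℝ) 1 := ⟨by linarith [hζ.1, hξ.1], by linarith [hζ.2, hξ.2]⟩
  have hsc := (B.selfConc_quadratic hx (d := ζ • d)
    (by rw [hvt ζ hζ01]; linarith [hζ01.2]) d).2
  rw [hvt ζ hζ01, ← vnorm_sq (B.hess_posdef x hx), hd] at hsc
  have h4 : 1 / 16 ≤ d ⬝ᵥ (B.hess (x + ζ • d) *ᵥ d) := by
    nlinarith [hζ01.1, hζ01.2]
  rw [hζ'] at h4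
  rw [dotProduct_comm, dotProduct_comm _ d] at hξ'
  norm_num at h4 hξ' ⊢
  linarith

end LHSCB

namespace LHSCBPair

variable {n : ℕ} {ν : ℝ} (Bp : LHSCBPair n ν)

theorem bddAbove_conj {s : Fin n → ℝ} (hs : s ∈ interior Bp.Bstar.K) :
    BddAbove ((fun x => -(s ⬝ᵥ x) - Bp.B.F x) '' interior Bp.B.K) := by
  by_contra h
  have h2 : ¬ BddAbove ((fun x => -(((2 : ℝ) • s) ⬝ᵥ x) - Bp.B.F x) '' interior Bp.B.K) := by
    rintro ⟨M, hM⟩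
    refine h ⟨M - ν * Real.log 2⁻¹, ?_⟩
    rintro _ ⟨x, hx, rfl⟩
    have h3 := hM ⟨_, Bp.B.smul_mem_interior (by norm_num : (0 : ℝ) < 2⁻¹) hx, rfl⟩
    simp only [Bp.B.logHom 2⁻¹ (by norm_num) x hx, smul_dotProduct, dotProduct_smul,
      smul_eq_mul] at h3
    dsimp only
    linarith
  have h3 := Bp.conj_eq s hs
  have h4 := Bp.conj_eq _ (Bp.Bstar.smul_mem_interior two_pos hs)
  rw [Real.sSup_of_not_bddAbove h] at h3
  rw [Real.sSup_of_not_bddAbove h2, Bp.Bstar.logHom 2 two_pos s hs, h3] at h4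
  have := mul_pos Bp.B.nu_pos (Real.log_pos one_lt_two)
  linarith

theorem fenchel_young {s x : Fin n → ℝ} (hs : s ∈ interior Bp.Bstar.K)
    (hx : x ∈ interior Bp.B.K) : -(s ⬝ᵥ x) - Bp.B.F x ≤ Bp.Bstar.F s := by
  rw [Bp.conj_eq s hs]
  exact le_csSup (Bp.bddAbove_conj hs) ⟨x, hx, rfl⟩

theorem exists_near_maximizer {s : Fin n → ℝ} (hs : s ∈ interior Bp.Bstar.K) {ε : ℝ}
    (hε : 0 < ε) : ∃ y ∈ interior Bp.B.K, Bp.Bstar.F s - ε < -(s ⬝ᵥ y) - Bp.B.F y := by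
  have h : Bp.Bstar.F s - ε < sSup ((fun x => -(s ⬝ᵥ x) - Bp.B.F x) '' interior Bp.B.K) := by
    rw [← Bp.conj_eq s hs]
    linarith
  obtain ⟨_, ⟨y, hy, rfl⟩, hlt⟩ := exists_lt_of_lt_csSup (Bp.B.cone_fullDim.image _) h
  exact ⟨y, hy, hlt⟩

/-- Near-maximizers of `x ↦ -⟨s, x⟩ - F x` are close to the negative gradient of `F_*` at `s`. -/
theorem near_maximizer_dist_le {s : Fin n → ℝ} (hs : s ∈ interior Bp.Bstar.K) {δ : ℝ}
    (hδ : 0 < δ) : ∃ ε > 0, ∀ y ∈ interior Bp.B.K,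
      Bp.Bstar.F s - ε < -(s ⬝ᵥ y) - Bp.B.F y → dist y (-Bp.Bstar.grad s) ≤ δ := by
  have hd := (Bp.Bstar.hasFDerivAt_F hs).isLittleO.def (half_pos hδ)
  obtain ⟨τ, hτ, hball⟩ := Metric.eventually_nhds_iff_ball.1
    (hd.and (isOpen_interior.mem_nhds hs))
  have hτ2 : 0 < τ / 2 := half_pos hτ
  refine ⟨δ / 2 * (τ / 2), by positivity, fun y hy hlt => ?_⟩
  have key : ∀ h : Fin n → ℝ, ‖h‖ = τ / 2 →
      -(h ⬝ᵥ (y - -Bp.Bstar.grad s)) ≤ δ * (τ / 2) := fun h hh => by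
    obtain ⟨h1, h2⟩ := hball (s + h) (by simp [hh, hτ])
    have h3 := Bp.fenchel_young h2 hy
    have h4 := le_of_abs_le h1
    simp only [add_sub_cancel_left, hh, LinearMap.coe_toContinuousLinearMap',
      dotProductBilin_apply_apply] at h4
    rw [add_dotProduct] at h3
    rw [sub_neg_eq_add, dotProduct_add, dotProduct_comm h (Bp.Bstar.grad s)]
    linarith
  refine (dist_pi_le_iff hδ.le).2 fun i => ?_
  have hn : ‖(Pi.single i (τ / 2) : Fin n → ℝ)‖ = τ / 2 := by
    rw [Pi.norm_single, Real.norm_of_nonneg hτ2.le]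
  have h1 := key _ hn
  have h2 := key (-Pi.single i (τ / 2)) (by rw [norm_neg, hn])
  rw [neg_dotProduct, single_dotProduct] at h2
  rw [single_dotProduct] at h1
  rw [Real.dist_eq, ← Pi.sub_apply, abs_le]
  constructor <;> refine le_of_mul_le_mul_left ?_ hτ2 <;> linarith

theorem vnorm_sub_lt_of_near_maximizer {s y z : Fin n → ℝ} (hs : s ∈ interior Bp.Bstar.K)
    (hy : y ∈ interior Bp.B.K) (hz : z ∈ interior Bp.B.K)
    (hyε : Bp.Bstar.F s - 1 / 128 < -(s ⬝ᵥ y) - Bp.B.F y)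
    (hzε : Bp.Bstar.F s - 1 / 128 < -(s ⬝ᵥ z) - Bp.B.F z) :
    vnorm (Bp.B.hess y) (z - y) < 1 / 2 := by
  by_contra! h
  set ρ := vnorm (Bp.B.hess y) (z - y) with hρ
  have hρ0 : 0 < ρ := by linarith
  set θ := 1 / 2 / ρ with hθ
  have hθ0 : 0 < θ := by positivity
  have hθ1 : θ ≤ 1 := (div_le_one hρ0).2 h
  have hd : vnorm (Bp.B.hess y) (θ • (z - y)) = 1 / 2 := by
    rw [vnorm_smul, abs_of_pos hθ0, ← hρ, hθ]
    field_simp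
  have hmid := Bp.B.midpoint_le hy hd
  have hmem : y + (1 / 2 : ℝ) • θ • (z - y) ∈ interior Bp.B.K :=
    Bp.B.add_mem_interior hy (by rw [vnorm_smul, hd]; norm_num)
  have hfy := Bp.fenchel_young hs hmem
  have hconv := Bp.B.strictConvex.convexOn.2 hy hz (sub_nonneg.2 hθ1) hθ0.le (by ring)
  have hcomb : (1 - θ) • y + θ • z = y + θ • (z - y) := by
    rw [smul_sub, sub_smul, one_smul]
    abel
  rw [hcomb, smul_eq_mul, smul_eq_mul] at hconv
  simp only [dotProduct_add, dotProduct_smul, dotProduct_sub, smul_eq_mul] at hfy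
  nlinarith

theorem neg_grad_mem_interior {s : Fin n → ℝ} (hs : s ∈ interior Bp.Bstar.K) :
    -Bp.Bstar.grad s ∈ interior Bp.B.K := by
  obtain ⟨y, hy, hyε⟩ := Bp.exists_near_maximizer hs (by norm_num : (0 : ℝ) < 1 / 128)
  have hcl : -Bp.Bstar.grad s ∈ closure {z | vnorm (Bp.B.hess y) (z - y) < 1 / 2} := by
    refine Metric.mem_closure_iff.2 fun δ hδ => ?_
    obtain ⟨ε, hε, hdist⟩ := Bp.near_maximizer_dist_le hs (half_pos hδ)
    obtain ⟨z, hz, hzε⟩ := Bp.exists_near_maximizer hs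
      (lt_min hε (by norm_num : (0 : ℝ) < 1 / 128))
    refine ⟨z, Bp.vnorm_sub_lt_of_near_maximizer hs hy hz hyε
      (by linarith [min_le_right ε (1 / 128)]), ?_⟩
    rw [dist_comm]
    exact (hdist z hz (by linarith [min_le_left ε (1 / 128)])).trans_lt (half_lt_self hδ)
  have hclosed : IsClosed {z | vnorm (Bp.B.hess y) (z - y) ≤ 1 / 2} :=
    isClosed_le ((continuous_vnorm _).comp (continuous_id.sub continuous_const)) continuous_const
  have h : vnorm (Bp.B.hess y) (-Bp.Bstar.grad s - y) ≤ 1 / 2 :=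
    closure_minimal (Set.ofPred_subset_ofPred.2 fun z hz => hz.le) hclosed hcl
  exact Bp.B.dikin y hy _ (lt_of_le_of_lt h (by norm_num))

theorem conj_eq_neg_grad {s : Fin n → ℝ} (hs : s ∈ interior Bp.Bstar.K) :
    Bp.Bstar.F s = -(s ⬝ᵥ -Bp.Bstar.grad s) - Bp.B.F (-Bp.Bstar.grad s) := by
  have hmem := Bp.neg_grad_mem_interior hs
  refine le_antisymm ?_ (Bp.fenchel_young hs hmem)
  by_contra! h
  have hcont : ContinuousAt (fun y => -(s ⬝ᵥ y) - Bp.B.F y) (-Bp.Bstar.grad s) := by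
    have h1 : Continuous fun y : Fin n → ℝ => -(s ⬝ᵥ y) := by fun_prop
    exact h1.continuousAt.sub (Bp.B.hasFDerivAt_F hmem).continuousAt
  set m := (Bp.Bstar.F s + (-(s ⬝ᵥ -Bp.Bstar.grad s) - Bp.B.F (-Bp.Bstar.grad s))) / 2 with hm
  obtain ⟨δ, hδ, hball⟩ := Metric.eventually_nhds_iff_ball.1
    (hcont.eventually_lt_const (show _ < m by linarith))
  obtain ⟨ε, hε, hdist⟩ := Bp.near_maximizer_dist_le hs (half_pos hδ)
  obtain ⟨z, hz, hzε⟩ := Bp.exists_near_maximizer hs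
    (lt_min hε (show 0 < Bp.Bstar.F s - m by linarith))
  have h1 := hball z ((hdist z hz (by linarith [min_le_left ε (Bp.Bstar.F s - m)])).trans_lt
    (half_lt_self hδ))
  linarith [min_le_right ε (Bp.Bstar.F s - m)]

/-- The negative gradients of `F` and `F_*` are mutually inverse. -/
theorem grad_neg_grad {s : Fin n → ℝ} (hs : s ∈ interior Bp.Bstar.K) :
    Bp.B.grad (-Bp.Bstar.grad s) = -s := by
  have hmem := Bp.neg_grad_mem_interior hs
  have hmin : IsLocalMin (fun y => s ⬝ᵥ y + Bp.B.F y) (-Bp.Bstar.grad s) := by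
    filter_upwards [isOpen_interior.mem_nhds hmem] with y hy
    have h1 := Bp.fenchel_young hs hy
    have h2 := Bp.conj_eq_neg_grad hs
    linarith
  have h := hmin.hasFDerivAt_eq_zero
    ((LinearMap.toContinuousLinearMap (dotProductBilin ℝ ℝ s)).hasFDerivAt.add
      (Bp.B.hasFDerivAt_F hmem))
  refine dotProduct_eq _ _ fun u => ?_
  have h2 : s ⬝ᵥ u + Bp.B.grad (-Bp.Bstar.grad s) ⬝ᵥ u = 0 := by
    simpa using congrArg (fun L => L u) h
  rw [neg_dotProduct]
  linarith

theorem inv_hess {s : Fin n → ℝ} (hs : s ∈ interior Bp.Bstar.K) :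
    (Bp.Bstar.hess s)⁻¹ = Bp.B.hess (-Bp.Bstar.grad s) := by
  refine Matrix.inv_eq_left_inv (Matrix.mulVec_injective (funext fun u => ?_))
  have h1 := (Bp.B.hasFDerivAt_grad (Bp.neg_grad_mem_interior hs)).comp s
    (Bp.Bstar.hasFDerivAt_grad hs).neg
  have h2 := h1.unique ((hasFDerivAt_id (𝕜 := ℝ) s).neg.congr_of_eventuallyEq (by
    filter_upwards [isOpen_interior.mem_nhds hs] with y hy using Bp.grad_neg_grad hy))
  have h3 := congrArg (fun L => L u) h2
  simpa [Matrix.mulVec_neg] using h3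

theorem dotProduct_pos {x s : Fin n → ℝ} (hx : x ∈ interior Bp.B.K)
    (hs : s ∈ interior Bp.Bstar.K) : 0 < x ⬝ᵥ s := by
  have hc : ContinuousAt (fun t : ℝ => s - t • x) 0 := by fun_prop
  have h0 : interior Bp.Bstar.K ∈ nhds (s - (0 : ℝ) • x) := by
    simpa using isOpen_interior.mem_nhds hs
  obtain ⟨δ, hδ, hball⟩ := Metric.eventually_nhds_iff_ball.1 (hc.eventually_mem h0)
  have h1 := interior_subset (hball (δ / 2) (by simp [abs_of_pos hδ, hδ]))
  rw [Bp.dual_eq] at h1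
  have h2 := h1 x (interior_subset hx)
  rw [dotProduct_sub, dotProduct_smul, smul_eq_mul] at h2
  have h3 : 0 < x ⬝ᵥ x := by
    simpa using dotProduct_star_self_pos_iff.2 (Bp.B.ne_zero_of_mem_interior hx)
  nlinarith

end LHSCBPair

section ScalarBounds

theorem abs_rank_one_difference_le {ν r N κ τ : ℝ} (hν : 1 ≤ ν) (hr0 : 0 < r) (hr1 : r < 1)
    (hN : 0 ≤ N) (hκ : |κ| ≤ r / (1 - r) * N) (hτ : |τ| ≤ √ν * N) :
    |((κ + τ) ^ 2 - τ ^ 2) / ν| ≤ (1 / ν) * (r + r ^ 2 / (1 - r) ^ 3) *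
      (r + r ^ 2 / (1 - r) ^ 3 + 2 * √ν) * N ^ 2 := by
  have hν0 : 0 < ν := by linarith
  have hρ : 0 < 1 - r := by linarith
  set D := r + r ^ 2 / (1 - r) ^ 3 with hD
  have hD1 : r / (1 - r) ≤ D := by
    have h1 : r / (1 - r) = r + r ^ 2 / (1 - r) := by field_simp; ring
    rw [h1]
    have h2 : (1 - r) ^ 3 ≤ 1 - r := pow_le_of_le_one hρ.le (by linarith) three_ne_zero
    exact add_le_add_right (div_le_div_of_nonneg_left (sq_nonneg r) (pow_pos hρ 3) h2) r
  have hD0 : 0 ≤ D := by positivity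
  have hκ' : |κ| ≤ D * N := hκ.trans (mul_le_mul_of_nonneg_right hD1 hN)
  have h1 : (κ + τ) ^ 2 - τ ^ 2 = κ * (κ + 2 * τ) := by ring
  have h2 : |κ + 2 * τ| ≤ (D + 2 * √ν) * N := by
    calc |κ + 2 * τ| ≤ |κ| + |2 * τ| := abs_add_le _ _
      _ = |κ| + 2 * |τ| := by rw [abs_mul, abs_two]
      _ ≤ (D + 2 * √ν) * N := by linarith
  rw [h1, abs_div, abs_mul, abs_of_pos hν0]
  calc |κ| * |κ + 2 * τ| / ν ≤ (D * N) * ((D + 2 * √ν) * N) / ν := by gcongr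
    _ = _ := by ring

theorem five_mul_div_le {r : ℝ} (hr0 : 0 < r) (hr1 : r ≤ 0.18226) :
    5 * r / (1 - 2 * r) ≤ (2 / ((1 - r) ^ 3 - r)) *
      (4 * r ^ 2 / (1 - r) ^ 3 + 2 * r
        + (3 * r ^ 2 / (1 - r) ^ 3 + r) ^ 2 / (r * (1 - 3 * r / (1 - r) ^ 3))) := by
  have hρ : 0 < 1 - r := by linarith
  have hcube : 3 * r < (1 - r) ^ 3 := by
    have h : (1 - 0.18226 : ℝ) ^ 3 ≤ (1 - r) ^ 3 := by gcongr
    norm_num at h hr1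
    linarith
  have hden : 0 < (1 - r) ^ 3 - r := by linarith
  have h3 : 0 < 1 - 3 * r / (1 - r) ^ 3 := sub_pos.2 ((div_lt_one (by positivity)).2 hcube)
  have h3' : 1 - 3 * r / (1 - r) ^ 3 ≤ 1 := by
    have : 0 ≤ 3 * r / (1 - r) ^ 3 := by positivity
    linarith
  have h4 : r ≤ (3 * r ^ 2 / (1 - r) ^ 3 + r) ^ 2 / (r * (1 - 3 * r / (1 - r) ^ 3)) := by
    rw [le_div_iff₀ (by positivity)]
    have h5 : r ^ 2 ≤ (3 * r ^ 2 / (1 - r) ^ 3 + r) ^ 2 := by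
      gcongr
      have : 0 ≤ 3 * r ^ 2 / (1 - r) ^ 3 := by positivity
      linarith
    nlinarith [sq_nonneg r]
  have h6 : 0 ≤ 4 * r ^ 2 / (1 - r) ^ 3 := by positivity
  calc 5 * r / (1 - 2 * r) ≤ 6 * r / ((1 - r) ^ 3 - r) := by
        refine div_le_div₀ (by linarith) (by linarith) hden ?_
        nlinarith [mul_pos hr0 hr0, mul_pos hr0 hρ]
    _ = (2 / ((1 - r) ^ 3 - r)) * (3 * r) := by ring
    _ ≤ _ := by gcongr; linarith

theorem rank_one_error_coefficient_le {r η a : ℝ} (hr0 : 0 < r) (hr1 : r < 1 / 2) (hη0 : 0 ≤ η)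
    (ha0 : 0 < a) (hηr : r ^ 2 = η * (1 - r)) (ha : a ≤ η) (hηa : η ≤ a / (1 - 2 * r)) :
    (η + a) * (2 * r + η) + (η * r + a ^ 2) ≤ 5 * r / (1 - 2 * r) * a := by
  have ht : 0 < 1 - 2 * r := by linarith
  have h0 : 5 * r / (1 - 2 * r) * a = 5 * r * (a / (1 - 2 * r)) := by ring
  rw [h0]
  set A := a / (1 - 2 * r) with hA
  have hAa : a = A * (1 - 2 * r) := by rw [hA]; field_simp
  have hA0 : 0 < A := by positivity
  have haA : a ≤ A := ha.trans hηa
  have hη2 : η ≤ 2 * r ^ 2 := by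
    have := mul_le_mul_of_nonneg_left hr1.le hη0
    linarith
  have h1 : (η + a) * (2 * r + η) ≤ (2 * A * (1 - r)) * (2 * r + η) := by
    gcongr
    linarith
  have h2 : (2 * A * (1 - r)) * (2 * r + η) = 4 * A * r - 2 * A * r ^ 2 := by
    have : (2 * A * (1 - r)) * (2 * r + η) = 4 * A * r * (1 - r) + 2 * A * (η * (1 - r)) := by ring
    rw [this, ← hηr]
    ring
  have h3 : η * r ≤ A * r := by gcongr
  have h4 : a ^ 2 ≤ A * (2 * r ^ 2) := by
    rw [pow_two]
    gcongr
    exact ha.trans hη2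
  linarith

/-- Distance between two rank-one quadratic forms whose generating vectors both lie
near a vector of length `r`. -/
theorem abs_normalized_rank_one_difference_le {ν r N a j P κ τ π b g : ℝ} (hν : 1 ≤ ν)
    (hr0 : 0 < r) (hr1 : r < 1 / 2) (hN : 0 ≤ N)
    (ha : a = r ^ 2 + j) (hj : |j| ≤ r ^ 2 / (1 - r) * r)
    (hP : P = r ^ 2 - a ^ 2 / ν) (hP0 : 0 < P)
    (hκ : κ = b + g) (hg : |g| ≤ r ^ 2 / (1 - r) * N) (hb : |b| ≤ r * N)
    (hπ : π = b + a / ν * τ) (hτ : |τ| ≤ √ν * N) (hπP : π ^ 2 ≤ P * N ^ 2) :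
    |κ ^ 2 / a - π ^ 2 / P| ≤ 5 * r / (1 - 2 * r) * N ^ 2 := by
  have hρ : 0 < 1 - r := by linarith
  have ht : 0 < 1 - 2 * r := by linarith
  have hν0 : 0 < ν := by linarith
  set η := r ^ 2 / (1 - r) with hη
  have hη0 : 0 < η := by positivity
  have hηr : r ^ 2 = η * (1 - r) := by rw [hη]; field_simp
  have hj' := abs_le.1 hj
  have ha_lo : η * (1 - 2 * r) ≤ a := by linarith
  have ha_hi : a ≤ η := by linarith
  have ha0 : 0 < a := lt_of_lt_of_le (mul_pos hη0 ht) ha_lo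
  have hηa : η ≤ a / (1 - 2 * r) := by rwa [le_div_iff₀ ht]
  have ha2 : 0 ≤ a ^ 2 / ν := by positivity
  have ha2' : a ^ 2 / ν ≤ a ^ 2 := div_le_self (sq_nonneg a) hν
  have hτa : |a / ν * τ| ≤ a * N := by
    rw [abs_mul, abs_of_pos (by positivity : 0 < a / ν)]
    have hs : √ν ≤ ν := Real.sqrt_le_iff.2 ⟨hν0.le, by nlinarith⟩
    calc a / ν * |τ| ≤ a / ν * (ν * N) := by
          gcongr
          exact hτ.trans (by gcongr)
      _ = a * N := by field_simp
  have hsub : |κ - π| ≤ (η + a) * N := by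
    have h : κ - π = g - a / ν * τ := by rw [hκ, hπ]; ring
    rw [h]
    exact (abs_sub _ _).trans (by linarith)
  have hπr : |π| ≤ r * N := by
    refine abs_le_of_sq_le_sq ?_ (by positivity)
    have : P * N ^ 2 ≤ r ^ 2 * N ^ 2 := by gcongr; linarith
    linarith [mul_pow r N 2]
  have hadd : |κ + π| ≤ (2 * r + η) * N := by
    have h : κ + π = b + g + π := by rw [hκ]
    rw [h]
    exact (abs_add_three _ _ _).trans (by linarith)
  have h1 : |κ ^ 2 - π ^ 2| ≤ (η + a) * (2 * r + η) * N ^ 2 := by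
    have h : κ ^ 2 - π ^ 2 = (κ - π) * (κ + π) := by ring
    rw [h, abs_mul]
    calc |κ - π| * |κ + π| ≤ ((η + a) * N) * ((2 * r + η) * N) := by gcongr
      _ = _ := by ring
  have h2 : |P - a| ≤ η * r + a ^ 2 := by
    rw [abs_le]
    constructor <;> linarith
  have h3 : |π ^ 2 / P * (P - a)| ≤ (η * r + a ^ 2) * N ^ 2 := by
    rw [abs_mul, abs_of_nonneg (by positivity), mul_comm]
    have h4 : π ^ 2 / P ≤ N ^ 2 := (div_le_iff₀ hP0).2 (by linarith)
    gcongr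
  have h4 : κ ^ 2 / a - π ^ 2 / P = ((κ ^ 2 - π ^ 2) + π ^ 2 / P * (P - a)) / a := by
    field_simp
    ring
  rw [h4, abs_div, abs_of_pos ha0, div_le_iff₀ ha0]
  have h5 := rank_one_error_coefficient_le hr0 hr1 hη0.le ha0 hηr ha_hi hηa
  calc |κ ^ 2 - π ^ 2 + π ^ 2 / P * (P - a)|
      ≤ |κ ^ 2 - π ^ 2| + |π ^ 2 / P * (P - a)| := abs_add_le _ _
    _ ≤ ((η + a) * (2 * r + η) + (η * r + a ^ 2)) * N ^ 2 := by linarith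
    _ ≤ 5 * r / (1 - 2 * r) * a * N ^ 2 := by gcongr
    _ = _ := by ring

end ScalarBounds

theorem dotProduct_vecMulVec_mulVec_self {n : ℕ} (u w : Fin n → ℝ) :
    u ⬝ᵥ (vecMulVec w w *ᵥ u) = (u ⬝ᵥ w) ^ 2 := by
  rw [Matrix.vecMulVec_mulVec, op_smul_eq_smul, dotProduct_smul, smul_eq_mul, dotProduct_comm w u,
    pow_two]

theorem isSymm_vecMulVec_self {n : ℕ} (w : Fin n → ℝ) : (vecMulVec w w).IsSymm :=
  Matrix.transpose_vecMulVec w w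

/-- Loewner bounds on the Dahl–Andersen scaling matrix `W` in terms of
`μ F''(x)` and `(1/μ) F_*''(s)⁻¹`, under `0 < ‖δP‖_x ≤ 0.18226`. -/
theorem stmt4 {n : ℕ} {ν : ℝ} (Bp : LHSCBPair n ν)
    (x s : Fin n → ℝ) (hx : x ∈ interior Bp.B.K) (hs : s ∈ interior Bp.Bstar.K)
    (st xt : Fin n → ℝ) (hst : st = -Bp.B.grad x) (hxt : xt = -Bp.Bstar.grad s)
    (μ μt : ℝ) (hμ : μ = x ⬝ᵥ s / ν) (hμt : μt = xt ⬝ᵥ st / ν)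
    (δP δD : Fin n → ℝ) (hδP : δP = x - μ • xt) (hδD : δD = s - μ • st)
    (r : ℝ) (hr : r = vnorm (Bp.B.hess x) δP)
    (hr0 : 0 < r) (hr1 : r ≤ 0.18226)
    (hip : δP ⬝ᵥ δD ≠ 0)
    (hden : vnorm (Bp.B.hess x) xt ^ 2 ≠ ν * μt ^ 2)
    (W : Matrix (Fin n) (Fin n) ℝ)
    (hW : W = μ • Bp.B.hess x + (ν * μ)⁻¹ • vecMulVec s s - (μ / ν) • vecMulVec st st
        + (δP ⬝ᵥ δD)⁻¹ • vecMulVec δD δD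
        - (μ / (vnorm (Bp.B.hess x) xt ^ 2 - ν * μt ^ 2)) •
            vecMulVec (Bp.B.hess x *ᵥ xt - μt • st) (Bp.B.hess x *ᵥ xt - μt • st))
    (ε₁ ε₂ : ℝ)
    (hε₁ : ε₁ = (1 / ν) * (r + r ^ 2 / (1 - r) ^ 3) * (r + r ^ 2 / (1 - r) ^ 3 + 2 * Real.sqrt ν))
    (hε₂ : ε₂ = (2 / ((1 - r) ^ 3 - r)) *
        (4 * r ^ 2 / (1 - r) ^ 3 + 2 * r
          + (3 * r ^ 2 / (1 - r) ^ 3 + r) ^ 2 / (r * (1 - 3 * r / (1 - r) ^ 3)))) :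
    Loewner (((1 - ε₁ - ε₂) * μ) • Bp.B.hess x) W ∧
    Loewner W (((1 + ε₁ + ε₂) * μ) • Bp.B.hess x) ∧
    Loewner (((1 - ε₁ - ε₂) * (1 - r) ^ 2 / μ) • (Bp.Bstar.hess s)⁻¹) W ∧
    Loewner W ((((1 + ε₁ + ε₂) / (1 - r) ^ 2) / μ) • (Bp.Bstar.hess s)⁻¹) := by
  set H := Bp.B.hess x with hH
  have hpd : H.PosDef := Bp.B.hess_posdef x hx
  have hsymm : H.IsSymm := Bp.B.hess_symm x hx
  have hν1 : 1 ≤ ν := Bp.B.nu_ge_one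
  have hν0 : 0 < ν := Bp.B.nu_pos
  have hμ0 : 0 < μ := by
    rw [hμ]
    exact div_pos (Bp.dotProduct_pos hx hs) hν0
  have hxtK : xt ∈ interior Bp.B.K := hxt ▸ Bp.neg_grad_mem_interior hs
  have hyK : μ • xt ∈ interior Bp.B.K := Bp.B.smul_mem_interior hμ0 hxtK
  have hgradxt : Bp.B.grad xt = -s := hxt ▸ Bp.grad_neg_grad hs
  have hinv : (Bp.Bstar.hess s)⁻¹ = Bp.B.hess xt := hxt ▸ Bp.inv_hess hs
  have hHx : H *ᵥ x = st := by rw [hst, hH, Bp.B.hess_mulVec_self hx]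
  have hxst : x ⬝ᵥ st = ν := by
    rw [hst, dotProduct_neg, dotProduct_comm, Bp.B.grad_dotProduct_self hx, neg_neg]
  have hxts : xt ⬝ᵥ s = ν := by
    have := Bp.B.grad_dotProduct_self hxtK
    rw [hgradxt, neg_dotProduct, dotProduct_comm] at this
    linarith
  have hxs : x ⬝ᵥ s = ν * μ := by rw [hμ]; field_simp
  have hxtst : xt ⬝ᵥ st = ν * μt := by rw [hμt]; field_simp
  have hr_half : r < 1 / 2 := by linarith
  have hρ : 0 < 1 - r := by linarith
  set a := ν * (μ * μt - 1) with ha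
  have hPD : δP ⬝ᵥ δD = μ * a := by
    rw [hδP, hδD, ha]
    simp only [dotProduct_sub, sub_dotProduct, dotProduct_smul, smul_dotProduct, smul_eq_mul, hxst,
      hxts, hxs, hxtst]
    ring
  have hPst : δP ⬝ᵥ st = -a := by
    rw [hδP, ha, sub_dotProduct, smul_dotProduct, smul_eq_mul, hxst, hxtst]
    ring
  have hxHP : x ⬝ᵥ (H *ᵥ δP) = -a := by
    rw [dotProduct_mulVec_symm hsymm, hHx, hPst]
  have hPP : δP ⬝ᵥ (H *ᵥ δP) = r ^ 2 := by rw [hr, vnorm_sq hpd]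
  have hxnorm : vnorm H x = √ν := by rw [vnorm, hHx, hxst]
  have hdneg : vnorm H (-δP) = r := by rw [vnorm_neg, ← hr]
  have hxd : x + -δP = μ • xt := by rw [hδP]; abel
  have hgap : ∀ u, |u ⬝ᵥ (μ⁻¹ • δD) - u ⬝ᵥ (H *ᵥ δP)| ≤ r ^ 2 / (1 - r) * vnorm H u := fun u => by
    have h := Bp.B.abs_dotProduct_grad_add_le hx (d := -δP) (by rw [← hH, hdneg]; linarith) u
    rw [hxd, ← hH, hdneg, Bp.B.grad_smul hμ0 hxtK, hgradxt, ← abs_neg] at h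
    convert h using 2
    have hg : Bp.B.grad x = -st := by rw [hst, neg_neg]
    rw [hδD, hg]
    simp only [dotProduct_sub, dotProduct_smul, dotProduct_neg, Matrix.mulVec_neg, smul_eq_mul,
      mul_sub, inv_mul_cancel_left₀ hμ0.ne']
    ring
  set j := δP ⬝ᵥ (μ⁻¹ • δD) - r ^ 2 with hj
  have haj : a = r ^ 2 + j := by
    rw [hj, dotProduct_smul, hPD, smul_eq_mul, inv_mul_cancel_left₀ hμ0.ne']
    ring
  have hj_le : |j| ≤ r ^ 2 / (1 - r) * r := by
    have h := hgap δP
    rwa [hPP, ← hr] at h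
  have ha0 : 0 < a := by
    have h1 : r ^ 2 / (1 - r) * r < r ^ 2 := by
      rw [div_mul_eq_mul_div, div_lt_iff₀ hρ]
      gcongr
      linarith
    linarith [neg_le_of_abs_le hj_le]
  set p := δP + (a / ν) • x with hp
  set P := r ^ 2 - a ^ 2 / ν with hP
  have hHp : H *ᵥ p = H *ᵥ δP + (a / ν) • st := by
    rw [hp, Matrix.mulVec_add, Matrix.mulVec_smul, hHx]
  have hpp : p ⬝ᵥ (H *ᵥ p) = P := by
    rw [hHp, hp]
    simp only [dotProduct_add, add_dotProduct, dotProduct_smul, smul_dotProduct, smul_eq_mul, hPP,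
      hPst, hxHP, hxst, hP]
    field_simp
    ring
  have hxp : x ⬝ᵥ (H *ᵥ p) = 0 := by
    rw [hHp, dotProduct_add, dotProduct_smul, smul_eq_mul, hxHP, hxst]
    field_simp
    ring
  have hxtv : μ • xt = x - δP := by rw [hδP]; abel
  have hQ : vnorm H xt ^ 2 - ν * μt ^ 2 = P / μ ^ 2 := by
    have h1 : (x - δP) ⬝ᵥ (H *ᵥ (x - δP)) = μ ^ 2 * vnorm H xt ^ 2 := by
      rw [vnorm_sq hpd, ← hxtv, Matrix.mulVec_smul, dotProduct_smul, smul_dotProduct]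
      simp only [smul_eq_mul]
      ring
    have h2 : (x - δP) ⬝ᵥ (H *ᵥ (x - δP)) = ν + 2 * a + r ^ 2 := by
      simp only [Matrix.mulVec_sub, dotProduct_sub, sub_dotProduct, hHx, hxst, hPst, hxHP, hPP]
      ring
    rw [eq_div_iff (pow_ne_zero 2 hμ0.ne')]
    have h3 : μ * μt = 1 + a / ν := by rw [ha]; field_simp; ring
    have h4 : (vnorm H xt ^ 2 - ν * μt ^ 2) * μ ^ 2 =
        μ ^ 2 * vnorm H xt ^ 2 - ν * (μ * μt) ^ 2 := by ring
    rw [h4, ← h1, h2, h3, hP]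
    field_simp
    ring
  have hP0 : 0 < P := by
    refine lt_of_le_of_ne (hpp ▸ hpd.dotProduct_mulVec_self_nonneg p) fun h => hden ?_
    rw [← h, zero_div] at hQ
    linarith
  have hWp : H *ᵥ xt - μt • st = -(μ⁻¹ • (H *ᵥ p)) := by
    have h1 : H *ᵥ xt = μ⁻¹ • (st - H *ᵥ δP) := by
      rw [← hHx, ← Matrix.mulVec_sub, ← hxtv, Matrix.mulVec_smul, smul_smul,
        inv_mul_cancel₀ hμ0.ne', one_smul]
    have h2 : μt = μ⁻¹ * (1 + a / ν) := by rw [ha]; field_simp; ring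
    rw [h1, h2, hHp, mul_smul, ← smul_sub, ← smul_neg]
    congr 1
    module
  have hWsymm : W.IsSymm := by
    rw [hW]
    exact (((((hsymm.smul _).add ((isSymm_vecMulVec_self _).smul _)).sub
      ((isSymm_vecMulVec_self _).smul _)).add ((isSymm_vecMulVec_self _).smul _)).sub
      ((isSymm_vecMulVec_self _).smul _))
  have hs_eq : s = μ • (st + μ⁻¹ • δD) := by
    rw [hδD, smul_add, smul_smul, mul_inv_cancel₀ hμ0.ne', one_smul]
    abel
  have hWu : ∀ u, u ⬝ᵥ (W *ᵥ u) = μ * (u ⬝ᵥ (H *ᵥ u)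
      + ((u ⬝ᵥ (μ⁻¹ • δD) + u ⬝ᵥ st) ^ 2 - (u ⬝ᵥ st) ^ 2) / ν
      + ((u ⬝ᵥ (μ⁻¹ • δD)) ^ 2 / a - (u ⬝ᵥ (H *ᵥ p)) ^ 2 / P)) := fun u => by
    have h1 : u ⬝ᵥ s = μ * (u ⬝ᵥ (μ⁻¹ • δD) + u ⬝ᵥ st) := by
      conv_lhs => rw [hs_eq]
      rw [dotProduct_smul, dotProduct_add, smul_eq_mul]
      ring
    have h2 : u ⬝ᵥ δD = μ * (u ⬝ᵥ (μ⁻¹ • δD)) := by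
      rw [dotProduct_smul, smul_eq_mul, mul_inv_cancel_left₀ hμ0.ne']
    have h3 : u ⬝ᵥ -(μ⁻¹ • (H *ᵥ p)) = -(μ⁻¹ * u ⬝ᵥ (H *ᵥ p)) := by
      rw [dotProduct_neg, dotProduct_smul, smul_eq_mul]
    rw [hW, hQ, hWp, hPD]
    simp only [Matrix.add_mulVec, Matrix.sub_mulVec, Matrix.smul_mulVec, dotProduct_add,
      dotProduct_sub, dotProduct_smul _ u, smul_eq_mul, dotProduct_vecMulVec_mulVec_self, h1, h3]
    rw [h2]
    generalize u ⬝ᵥ (μ⁻¹ • δD) = κ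
    field_simp
    ring
  have hBessel : ∀ u, (u ⬝ᵥ st) ^ 2 / ν + (u ⬝ᵥ (H *ᵥ p)) ^ 2 / P ≤ u ⬝ᵥ (H *ᵥ u) := fun u => by
    have h := hpd.dotProduct_mulVec_self_nonneg
      (u - (u ⬝ᵥ st / ν) • x - (u ⬝ᵥ (H *ᵥ p) / P) • p)
    simp only [Matrix.mulVec_sub, Matrix.mulVec_smul, dotProduct_sub, sub_dotProduct,
      dotProduct_smul, smul_dotProduct, smul_eq_mul, hHx, hxst, hpp, hxp,
      dotProduct_mulVec_symm hsymm x u, dotProduct_mulVec_symm hsymm p u] at h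
    have h0 : p ⬝ᵥ st = 0 := by rw [← hHx, dotProduct_mulVec_symm hsymm, hxp]
    rw [h0] at h
    refine le_of_sub_nonneg (h.trans_eq ?_)
    field_simp
    ring
  have hWnonneg : ∀ u, 0 ≤ u ⬝ᵥ (W *ᵥ u) := fun u => by
    rw [hWu]
    have h1 := hBessel u
    have h2 : 0 ≤ (u ⬝ᵥ (μ⁻¹ • δD) + u ⬝ᵥ st) ^ 2 / ν := by positivity
    have h3 : 0 ≤ (u ⬝ᵥ (μ⁻¹ • δD)) ^ 2 / a := by positivity
    rw [sub_div]
    exact mul_nonneg hμ0.le (by linarith)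
  have hbound : ∀ u, |u ⬝ᵥ (W *ᵥ u) - μ * (u ⬝ᵥ (H *ᵥ u))| ≤
      (ε₁ + ε₂) * (μ * (u ⬝ᵥ (H *ᵥ u))) := fun u => by
    have hN := vnorm_nonneg H u
    have hg := hgap u
    have hb : |u ⬝ᵥ (H *ᵥ δP)| ≤ r * vnorm H u := by
      rw [hr, mul_comm]
      exact abs_dotProduct_mulVec_le_vnorm hpd u δP
    have hτ : |u ⬝ᵥ st| ≤ √ν * vnorm H u := by
      rw [← hHx, ← hxnorm, mul_comm]
      exact abs_dotProduct_mulVec_le_vnorm hpd u x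
    have hκ : |u ⬝ᵥ (μ⁻¹ • δD)| ≤ r / (1 - r) * vnorm H u := by
      have h1 := abs_add_le (u ⬝ᵥ (H *ᵥ δP)) (u ⬝ᵥ (μ⁻¹ • δD) - u ⬝ᵥ (H *ᵥ δP))
      rw [add_sub_cancel] at h1
      have h2 : r / (1 - r) = r + r ^ 2 / (1 - r) := by field_simp; ring
      rw [h2]
      linarith
    have h1 := abs_rank_one_difference_le hν1 hr0 (by linarith) hN hκ hτ
    have hπP : (u ⬝ᵥ (H *ᵥ p)) ^ 2 ≤ P * vnorm H u ^ 2 := by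
      rw [vnorm_sq hpd, ← div_le_iff₀' hP0]
      have h2 : 0 ≤ (u ⬝ᵥ st) ^ 2 / ν := by positivity
      linarith [hBessel u]
    have h2 := abs_normalized_rank_one_difference_le hν1 hr0 hr_half hN haj hj_le hP hP0
      (add_sub_cancel _ _).symm hg hb
      (show u ⬝ᵥ (H *ᵥ p) = u ⬝ᵥ (H *ᵥ δP) + a / ν * (u ⬝ᵥ st) by
        rw [hHp, dotProduct_add, dotProduct_smul, smul_eq_mul]) hτ hπP
    have h3 := mul_le_mul_of_nonneg_right (five_mul_div_le hr0 hr1) (sq_nonneg (vnorm H u))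
    rw [← hε₂] at h3
    rw [← hε₁] at h1
    rw [vnorm_sq hpd] at h1 h2 h3
    rw [hWu, ← mul_sub, abs_mul, abs_of_pos hμ0, mul_left_comm]
    refine mul_le_mul_of_nonneg_left ?_ hμ0.le
    rw [add_assoc, add_sub_cancel_left]
    exact (abs_add_le _ _).trans (by linarith)
  have hε0 : 0 ≤ ε₁ + ε₂ := by
    have h1 := (abs_nonneg _).trans (hbound x)
    rw [hHx, hxst] at h1
    exact nonneg_of_mul_nonneg_left h1 (mul_pos hμ0 hν0)
  have hupper : ∀ u, u ⬝ᵥ (W *ᵥ u) ≤ (1 + ε₁ + ε₂) * μ * (u ⬝ᵥ (H *ᵥ u)) := fun u => by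
    linarith [le_of_abs_le (hbound u)]
  have hlower : ∀ u, (1 - ε₁ - ε₂) * μ * (u ⬝ᵥ (H *ᵥ u)) ≤ u ⬝ᵥ (W *ᵥ u) := fun u => by
    linarith [neg_le_of_abs_le (hbound u)]
  have hHxt : ∀ u, (1 - r) ^ 2 * (u ⬝ᵥ (Bp.B.hess xt *ᵥ u)) ≤ μ ^ 2 * (u ⬝ᵥ (H *ᵥ u)) ∧
      (1 - r) ^ 2 * (μ ^ 2 * (u ⬝ᵥ (H *ᵥ u))) ≤ u ⬝ᵥ (Bp.B.hess xt *ᵥ u) := fun u => by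
    have h := Bp.B.selfConc_quadratic hx (d := -δP) (by rw [← hH, hdneg]; linarith) u
    rw [hxd, ← hH, hdneg, Bp.B.hess_smul hμ0 hxtK, Matrix.smul_mulVec, dotProduct_smul,
      smul_eq_mul] at h
    obtain ⟨h1, h2⟩ := h
    have hμ2 : 0 < μ ^ 2 := by positivity
    rw [mul_left_comm, inv_mul_le_iff₀ hμ2] at h1
    rw [← div_eq_inv_mul, le_div_iff₀ hμ2] at h2
    exact ⟨h1, by linarith⟩
  have hxtsymm : (Bp.B.hess xt).IsSymm := Bp.B.hess_symm xt hxtK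
  rw [hinv, loewner_iff (hsymm.smul _) hWsymm, loewner_iff hWsymm (hsymm.smul _),
    loewner_iff (hxtsymm.smul _) hWsymm, loewner_iff hWsymm (hxtsymm.smul _)]
  simp only [Matrix.smul_mulVec, dotProduct_smul, smul_eq_mul]
  refine ⟨hlower, hupper, fun u => ?_, fun u => ?_⟩
  · rcases le_total 0 (1 - ε₁ - ε₂) with h | h
    · refine le_trans ?_ (hlower u)
      calc (1 - ε₁ - ε₂) * (1 - r) ^ 2 / μ * (u ⬝ᵥ (Bp.B.hess xt *ᵥ u))
          = (1 - ε₁ - ε₂) / μ * ((1 - r) ^ 2 * (u ⬝ᵥ (Bp.B.hess xt *ᵥ u))) := by ring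
        _ ≤ (1 - ε₁ - ε₂) / μ * (μ ^ 2 * (u ⬝ᵥ (H *ᵥ u))) :=
            mul_le_mul_of_nonneg_left (hHxt u).1 (div_nonneg h hμ0.le)
        _ = (1 - ε₁ - ε₂) * μ * (u ⬝ᵥ (H *ᵥ u)) := by field_simp
    · refine le_trans (mul_nonpos_of_nonpos_of_nonneg ?_ ?_) (hWnonneg u)
      · exact div_nonpos_of_nonpos_of_nonneg
          (mul_nonpos_of_nonpos_of_nonneg h (sq_nonneg _)) hμ0.le
      · exact (Bp.B.hess_posdef xt hxtK).dotProduct_mulVec_self_nonneg u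
  · refine (hupper u).trans ?_
    have hc : 0 ≤ (1 + ε₁ + ε₂) / (1 - r) ^ 2 / μ :=
      div_nonneg (div_nonneg (by linarith) (sq_nonneg _)) hμ0.le
    calc (1 + ε₁ + ε₂) * μ * (u ⬝ᵥ (H *ᵥ u))
        = (1 + ε₁ + ε₂) / (1 - r) ^ 2 / μ * ((1 - r) ^ 2 * (μ ^ 2 * (u ⬝ᵥ (H *ᵥ u)))) := by
          field_simp
      _ ≤ _ := mul_le_mul_of_nonneg_left (hHxt u).2 hc
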